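/- arXiv:1202.4876 — 2 statements merged into one kernel-verified Lean document; each statement's English description precedes it below -/
import Mathlib

section
/- Let f : [a, a+L] → ℝ and suppose there exist M > 0 and ρ ∈ (0,1] such that |f^{(k)}(x)| ≤ M k! (2ρL)^{−k} for all k ≥ 0 and x ∈ [a, a+L]. Let F ⊆ [a, a+L] be measurable with |F| > 0. Then there exist constants N and γ ∈ (0,1), depending only on ρ and |F|/L, such that sup_{[a,a+L]} |f| ≤ N (⨍_F |f| dτ)^γ M^{1−γ}, where ⨍_F denotes the average over F. -/
open MeasureTheory Set

lemma exists_separated_points (s : ℝ) (hs : 0 ≤ s) (c : ℝ) (n : ℕ) :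
    ∀ (d : ℝ) (E : Set ℝ), E ⊆ Icc c d → ENNReal.ofReal (n * s) < volume E →
      ∃ x : ℕ → ℝ, (∀ i ≤ n, x i ∈ E) ∧ ∀ i < n, x i + s ≤ x (i + 1) := by
  induction n with
  | zero =>
    intro d E _ hvol
    obtain ⟨y, hy⟩ := nonempty_of_measure_ne_zero (bot_lt_iff_ne_bot.1 (bot_le.trans_lt hvol))
    exact ⟨fun _ => y, fun _ _ => hy, fun i hi => absurd hi (Nat.not_lt_zero i)⟩
  | succ n ih =>
    intro d E hE hvol
    have hne : E.Nonempty :=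
      nonempty_of_measure_ne_zero (bot_lt_iff_ne_bot.1 (bot_le.trans_lt hvol))
    have hbdd : BddAbove E := ⟨d, fun y hy => (hE hy).2⟩
    have hfin : volume E ≠ ⊤ :=
      ((measure_mono hE).trans_lt (by rw [Real.volume_Icc]; exact ENNReal.ofReal_lt_top)).ne
    obtain ⟨v, hv⟩ : ∃ v : ℝ, v = (volume E).toReal := ⟨_, rfl⟩
    have hgap : (n + 1) * s < v := by
      have := (ENNReal.ofReal_lt_iff_lt_toReal (by positivity) hfin).1 hvol
      push_cast at this
      rwa [hv]
    obtain ⟨y, hyE, hy⟩ := exists_lt_of_lt_csSup hne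
      (show sSup E - (v - (n + 1) * s) < sSup E by linarith)
    have hsub : E ⊆ (E ∩ Iic (y - s)) ∪ Icc (y - s) (sSup E) := by
      intro z hz
      rcases le_total z (y - s) with h | h
      · exact Or.inl ⟨hz, h⟩
      · exact Or.inr ⟨h, le_csSup hbdd hz⟩
    have hvol' : ENNReal.ofReal (n * s) < volume (E ∩ Iic (y - s)) := by
      by_contra! hcon
      have h1 : volume E ≤ ENNReal.ofReal (n * s) + ENNReal.ofReal (sSup E - (y - s)) := by
        refine (measure_mono hsub).trans ((measure_union_le _ _).trans ?_)
        rw [Real.volume_Icc]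
        gcongr
      have hys : y ≤ sSup E := le_csSup hbdd hyE
      rw [← ENNReal.ofReal_add (by positivity) (by linarith)] at h1
      have h2 := ENNReal.toReal_mono ENNReal.ofReal_ne_top h1
      rw [ENNReal.toReal_ofReal (by nlinarith [mul_nonneg (Nat.cast_nonneg (α := ℝ) n) hs]),
        ← hv] at h2
      nlinarith
    obtain ⟨x, hxE, hx⟩ := ih d (E ∩ Iic (y - s)) (inter_subset_left.trans hE) hvol'
    refine ⟨fun i => if i ≤ n then x i else y, fun i _ => ?_, fun i hi => ?_⟩
    · by_cases h : i ≤ n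
      · simpa [h] using (hxE i h).1
      · simpa [h] using hyE
    · rcases (Nat.lt_succ_iff.1 hi).lt_or_eq with h | rfl
      · simpa [h.le, Nat.succ_le_of_lt h] using hx i h
      · have := (hxE i le_rfl).2
        simp only [mem_Iic] at this
        simp only [le_refl, if_true, Nat.not_succ_le_self, if_false]
        linarith

lemma mul_sub_le_of_separated {x : ℕ → ℝ} {s : ℝ} {n : ℕ} (hx : ∀ i < n, x i + s ≤ x (i + 1))
    {i j : ℕ} (hij : i ≤ j) (hj : j ≤ n) : ((j - i : ℕ) : ℝ) * s ≤ x j - x i := by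
  induction j, hij using Nat.le_induction with
  | base => simp
  | succ j hij ih =>
    have h1 := ih (by omega)
    have h2 := hx j (by omega)
    rw [Nat.sub_add_comm hij]
    push_cast
    linarith

lemma factorial_mul_factorial_eq_prod_dist {i n : ℕ} (hi : i ≤ n) :
    ∏ j ∈ (Finset.range (n + 1)).erase i, ((i - j : ℕ) + (j - i : ℕ)) =
      Nat.factorial i * Nat.factorial (n - i) := by
  have h : (Finset.range (n + 1)).erase i = Finset.range i ∪ Finset.Ico (i + 1) (n + 1) := by
    ext j; simp; omega
  have hd : Disjoint (Finset.range i) (Finset.Ico (i + 1) (n + 1)) := by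
    rw [Finset.disjoint_left]; intro j; simp; omega
  rw [h, Finset.prod_union hd]
  congr 1
  · rw [← Finset.prod_range_add_one_eq_factorial, ← Finset.prod_range_reflect]
    refine Finset.prod_congr rfl fun j hj => ?_
    simp at hj; omega
  · rw [← Finset.prod_range_add_one_eq_factorial, Finset.prod_Ico_eq_prod_range]
    refine Finset.prod_congr (by congr 1; omega) fun j hj => ?_
    omega

lemma abs_eval_basis_le {x : ℕ → ℝ} {s c d : ℝ} {n : ℕ} (hs : 0 < s)
    (hx : ∀ i < n, x i + s ≤ x (i + 1)) (hmem : ∀ i ≤ n, x i ∈ Icc c d) {y : ℝ}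
    (hy : y ∈ Icc c d) {i : ℕ} (hi : i ≤ n) :
    |(Lagrange.basis (Finset.range (n + 1)) x i).eval y| ≤
      (2 * (d - c) / s) ^ n / Nat.factorial n := by
  have hcd : 0 ≤ d - c := by linarith [hy.1, hy.2]
  have hfac : (Nat.factorial n : ℝ) ≤ 2 ^ n * (Nat.factorial i * Nat.factorial (n - i)) := by
    have h1 := Nat.choose_mul_factorial_mul_factorial hi
    have h2 := Nat.choose_le_two_pow n i
    have : Nat.factorial n ≤ 2 ^ n * (Nat.factorial i * Nat.factorial (n - i)) := by
      rw [← h1, mul_assoc]; gcongr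
    exact_mod_cast this
  have hcard : ((Finset.range (n + 1)).erase i).card = n := by
    rw [Finset.card_erase_of_mem (by simp; omega)]; simp
  have hbound : |(Lagrange.basis (Finset.range (n + 1)) x i).eval y| ≤
      ∏ j ∈ (Finset.range (n + 1)).erase i,
        ((d - c) / s) / (((i - j : ℕ) + (j - i : ℕ) : ℕ) : ℝ) := by
    rw [Lagrange.basis, Polynomial.eval_prod, Finset.abs_prod]
    refine Finset.prod_le_prod (fun _ _ => abs_nonneg _) fun j hj => ?_
    simp only [Finset.mem_erase, Finset.mem_range] at hj
    have hj' : j ≤ n := by omega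
    have hdist : (((i - j : ℕ) + (j - i : ℕ) : ℕ) : ℝ) * s ≤ |x i - x j| := by
      rcases le_total i j with h | h
      · have := mul_sub_le_of_separated hx h hj'
        rw [Nat.sub_eq_zero_of_le h, zero_add, abs_sub_comm]
        exact this.trans (le_abs_self _)
      · have := mul_sub_le_of_separated hx h hi
        rw [Nat.sub_eq_zero_of_le h, add_zero]
        exact this.trans (le_abs_self _)
    have hpos : (0 : ℝ) < (((i - j : ℕ) + (j - i : ℕ) : ℕ) : ℝ) := by
      have : 0 < (i - j) + (j - i) := by omega
      exact_mod_cast this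
    have hyx : |y - x j| ≤ d - c := by
      have := hmem j hj'
      rw [abs_le]; constructor <;> linarith [this.1, this.2, hy.1, hy.2]
    simp only [Lagrange.basisDivisor, Polynomial.eval_mul, Polynomial.eval_C, Polynomial.eval_sub,
      Polynomial.eval_X, abs_mul, abs_inv]
    rw [div_div, inv_mul_eq_div, mul_comm s]
    exact div_le_div₀ hcd hyx (by positivity) hdist
  refine hbound.trans ?_
  rw [Finset.prod_div_distrib, Finset.prod_const, hcard, ← Nat.cast_prod,
    factorial_mul_factorial_eq_prod_dist hi, mul_div_assoc, mul_pow, Nat.cast_mul]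
  rw [div_le_div_iff₀ (by positivity) (by positivity)]
  have : 0 ≤ ((d - c) / s) ^ n := by positivity
  nlinarith [mul_le_mul_of_nonneg_left hfac this]

/-- A Remez-type inequality: a polynomial of degree at most `n` bounded on a subset of relative
measure at least `δ` of an interval is bounded on the whole interval, with exponential loss. -/
lemma abs_eval_le_of_abs_eval_le_on {c d δ B : ℝ} (hcd : c < d) (hδ : 0 < δ) {E : Set ℝ}
    (hE : E ⊆ Icc c d) (hvol : ENNReal.ofReal (δ * (d - c)) ≤ volume E) {n : ℕ}
    {p : Polynomial ℝ} (hp : p.degree < (n + 1 : ℕ)) (hB : ∀ y ∈ E, |p.eval y| ≤ B) {y : ℝ}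
    (hy : y ∈ Icc c d) :
    |p.eval y| ≤ Real.exp 1 * (8 * Real.exp 1 / δ) ^ n * B := by
  have hdc : 0 < d - c := sub_pos.2 hcd
  obtain ⟨s, hs⟩ : ∃ s : ℝ, s = δ * (d - c) / (2 * (n + 1)) := ⟨_, rfl⟩
  have hs0 : 0 < s := by rw [hs]; positivity
  have hns : ENNReal.ofReal (n * s) < volume E := by
    refine lt_of_lt_of_le ((ENNReal.ofReal_lt_ofReal_iff (by positivity)).2 ?_) hvol
    have : s * (2 * (n + 1)) = δ * (d - c) := by rw [hs]; field_simp
    nlinarith [mul_nonneg (Nat.cast_nonneg (α := ℝ) n) hs0.le]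
  obtain ⟨x, hxE, hx⟩ := exists_separated_points s hs0.le c n d E hE hns
  have hinj : Set.InjOn x (Finset.range (n + 1)) := by
    have key : ∀ i j, i < j → j ≤ n → x i ≠ x j := by
      intro i j hij hj h
      have h1 := mul_sub_le_of_separated hx hij.le hj
      have h2 : (0 : ℝ) < ((j - i : ℕ) : ℝ) := by exact_mod_cast Nat.sub_pos_of_lt hij
      nlinarith [mul_pos h2 hs0]
    intro i hi j hj h
    simp only [Finset.coe_range, mem_Iio] at hi hj
    by_contra hne
    rcases lt_or_gt_of_ne hne with h' | h'
    · exact key i j h' (by omega) h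
    · exact key j i h' (by omega) h.symm
  have hB0 : 0 ≤ B := (abs_nonneg _).trans (hB _ (hxE 0 (Nat.zero_le _)))
  have hsum : |p.eval y| ≤ (n + 1) * (B * ((2 * (d - c) / s) ^ n / Nat.factorial n)) := by
    rw [Lagrange.eq_interpolate (f := p) hinj (by simpa using hp), Lagrange.interpolate_apply,
      Polynomial.eval_finsetSum]
    refine (Finset.abs_sum_le_sum_abs _ _).trans ((Finset.sum_le_card_nsmul _ _
      (B * ((2 * (d - c) / s) ^ n / Nat.factorial n)) fun i hi => ?_).trans_eq (by simp))
    have hi' : i ≤ n := by simpa [Nat.lt_succ_iff] using hi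
    rw [Polynomial.eval_mul, Polynomial.eval_C, abs_mul]
    exact mul_le_mul (hB _ (hxE i hi')) (abs_eval_basis_le hs0 hx (fun j hj => hE (hxE j hj)) hy hi')
      (abs_nonneg _) hB0
  have hratio : 2 * (d - c) / s = 4 / δ * (n + 1) := by rw [hs]; field_simp; norm_num
  have hn2 : (n + 1 : ℝ) ≤ 2 ^ n := by exact_mod_cast Nat.lt_two_pow_self (n := n)
  have hexp : (n + 1 : ℝ) ^ n / Nat.factorial n ≤ Real.exp 1 ^ (n + 1) := by
    have := Real.pow_div_factorial_le_exp (x := n + 1) (by positivity) n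
    rwa [← mul_one (n + 1 : ℝ), show (n + 1 : ℝ) * 1 = ((n + 1 : ℕ) : ℝ) * 1 by push_cast; ring,
      Real.exp_nat_mul, mul_one, Nat.cast_succ] at this
  calc |p.eval y| ≤ (n + 1) * (B * ((2 * (d - c) / s) ^ n / Nat.factorial n)) := hsum
    _ = (n + 1) * ((4 / δ) ^ n * ((n + 1 : ℝ) ^ n / Nat.factorial n)) * B := by
      rw [hratio, mul_pow]; ring
    _ ≤ 2 ^ n * ((4 / δ) ^ n * Real.exp 1 ^ (n + 1)) * B := by gcongr
    _ = Real.exp 1 * (8 * Real.exp 1 / δ) ^ n * B := by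
      rw [show 8 * Real.exp 1 / δ = 2 * (4 / δ) * Real.exp 1 by ring, mul_pow, mul_pow]; ring

lemma exists_polynomial_eval_eq_taylorWithinEval (f : ℝ → ℝ) (n : ℕ) (s : Set ℝ) (x₀ : ℝ) :
    ∃ p : Polynomial ℝ, p.degree < (n + 1 : ℕ) ∧ ∀ x, p.eval x = taylorWithinEval f n s x₀ x := by
  refine ⟨∑ k ∈ Finset.range (n + 1), ((Nat.factorial k : ℝ)⁻¹ *
    iteratedDerivWithin k f s x₀) • (Polynomial.X - Polynomial.C x₀) ^ k, ?_, fun x => ?_⟩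
  · refine (Polynomial.degree_sum_le _ _).trans_lt ?_
    rw [Finset.sup_lt_iff (WithBot.bot_lt_coe _)]
    intro k hk
    refine (Polynomial.degree_smul_le _ _).trans_lt ?_
    rw [Polynomial.degree_pow, Polynomial.degree_X_sub_C, nsmul_one]
    exact_mod_cast Finset.mem_range.1 hk
  · rw [taylor_within_apply, Polynomial.eval_finsetSum]
    refine Finset.sum_congr rfl fun k _ => ?_
    simp only [Polynomial.eval_smul, Polynomial.eval_C, Polynomial.eval_pow, Polynomial.eval_sub,
      Polynomial.eval_X, smul_eq_mul]
    ring

/-- Optimising `C ^ n * η + 2 ^ (-n)` over `n` gives a power of `η`. -/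
lemma exists_pow_mul_add_inv_two_pow_le_rpow {C : ℝ} (hC : 2 ≤ C) :
    ∃ γ ∈ Ioo (0 : ℝ) 1, ∀ η : ℝ, 0 < η → η ≤ 1 →
      ∃ n : ℕ, C ^ n * η + (1 / 2) ^ n ≤ 3 * η ^ γ := by
  have hC0 : 0 < C := by linarith
  have hlog2 : 0 < Real.log 2 := Real.log_pos one_lt_two
  have hlog : Real.log 2 ≤ Real.log C := Real.log_le_log two_pos hC
  obtain ⟨γ, hγ⟩ : ∃ γ : ℝ, γ = Real.log 2 / (2 * Real.log C) := ⟨_, rfl⟩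
  have hγ0 : 0 < γ := by rw [hγ]; exact div_pos hlog2 (by linarith)
  have hγ1 : γ ≤ 1 / 2 := by rw [hγ, div_le_div_iff₀ (by linarith) two_pos]; linarith
  have hCγ : (C ^ 2) ^ γ = 2 := by
    rw [← Real.rpow_natCast C 2, ← Real.rpow_mul hC0.le, Real.rpow_def_of_pos hC0]
    have : Real.log C * ((2 : ℕ) * γ) = Real.log 2 := by
      have : Real.log C ≠ 0 := by linarith
      rw [hγ]; field_simp; norm_num
    rw [this, Real.exp_log two_pos]
  refine ⟨γ, ⟨hγ0, by linarith⟩, fun η hη hη1 => ?_⟩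
  obtain ⟨n, hn1, hn2⟩ := exists_nat_pow_near (x := 1 / η) (y := C ^ 2)
    (by rw [le_div_iff₀ hη]; linarith) (by nlinarith)
  refine ⟨n, ?_⟩
  have h1 : C ^ n * η ≤ η ^ γ := by
    have hsq : (C ^ n * η) ^ 2 ≤ η := by
      rw [le_div_iff₀ hη, pow_right_comm] at hn1
      nlinarith
    calc C ^ n * η ≤ Real.sqrt η := Real.le_sqrt_of_sq_le hsq
      _ = η ^ (1 / 2 : ℝ) := Real.sqrt_eq_rpow η
      _ ≤ η ^ γ := Real.rpow_le_rpow_of_exponent_ge hη hη1 hγ1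
  have h2 : (1 / 2 : ℝ) ^ n ≤ 2 * η ^ γ := by
    have h := Real.rpow_le_rpow (by positivity) hn2.le hγ0.le
    rw [← Real.rpow_pow_comm (by positivity), hCγ, one_div, Real.inv_rpow hη.le,
      inv_le_comm₀ (Real.rpow_pos_of_pos hη γ) (by positivity)] at h
    calc (1 / 2 : ℝ) ^ n = 2 * ((2 : ℝ) ^ (n + 1))⁻¹ := by rw [one_div, inv_pow, pow_succ]; field_simp
      _ ≤ _ := by gcongr
  linarith

/-- A smooth function on `[c, d]` whose derivatives satisfy Cauchy estimates of radius `R` much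
larger than `d - c` is controlled on `[c, d]` by its size on a subset of relative measure `δ`. -/
lemma exists_local_propagation {δ : ℝ} (hδ : 0 < δ) (hδ1 : δ ≤ 1) :
    ∃ θ N γ : ℝ, 0 < θ ∧ 1 ≤ N ∧ γ ∈ Ioo (0 : ℝ) 1 ∧
      ∀ (c d R M η : ℝ) (f : ℝ → ℝ) (E : Set ℝ), c < d → d - c ≤ θ * R → 0 < M → 0 < η →
        ContDiffOn ℝ (⊤ : ℕ∞) f (Icc c d) →
        (∀ k : ℕ, ∀ x ∈ Icc c d,
          |iteratedDerivWithin k f (Icc c d) x| ≤ M * (Nat.factorial k) / R ^ k) →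
        E ⊆ Icc c d → ENNReal.ofReal (δ * (d - c)) ≤ volume E →
        (∀ x ∈ E, |f x| ≤ M * η) → ∀ x ∈ Icc c d, |f x| ≤ M * (N * η ^ γ) := by
  obtain ⟨C, hC⟩ : ∃ C : ℝ, C = 8 * Real.exp 1 / δ := ⟨_, rfl⟩
  have he : 1 ≤ Real.exp 1 := Real.one_le_exp zero_le_one
  have hC2 : 2 ≤ C := by rw [hC, le_div_iff₀ hδ]; nlinarith
  have hC0 : 0 < C := by linarith
  obtain ⟨γ, hγ, hopt⟩ := exists_pow_mul_add_inv_two_pow_le_rpow hC2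
  refine ⟨1 / (4 * C), 3 * (Real.exp 1 + 1), γ, by positivity, by linarith, hγ, ?_⟩
  intro c d R M η f E hcd hR hM hη hf hder hE hvol hfE x hx
  rcases lt_or_ge 1 η with hη1 | hη1
  · have h0 := hder 0 x hx
    simp only [iteratedDerivWithin_zero, Nat.factorial_zero, Nat.cast_one, mul_one, pow_zero,
      div_one] at h0
    have := Real.one_le_rpow hη1.le hγ.1.le
    refine h0.trans (le_mul_of_one_le_right hM.le ?_)
    nlinarith
  obtain ⟨n, hn⟩ := hopt η hη hη1
  have hdc : 0 < d - c := sub_pos.2 hcd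
  have hR0 : 0 < R := by
    by_contra! h
    have : 1 / (4 * C) * R ≤ 0 := mul_nonpos_of_nonneg_of_nonpos (by positivity) h
    linarith
  have hratio : (d - c) / R ≤ 1 / (4 * C) := by rwa [div_le_iff₀ hR0]
  have hn2 : (n + 1 : ℝ) ≤ 2 ^ n := by exact_mod_cast Nat.lt_two_pow_self (n := n)
  have hrem : ∀ y ∈ Icc c d, |f y - taylorWithinEval f n (Icc c d) c y| ≤
      M * (1 / (2 * C)) ^ n := by
    intro y hy
    have hyc : 0 ≤ y - c := sub_nonneg.2 hy.1
    refine (taylor_mean_remainder_bound hcd.le (hf.of_le (mod_cast le_top)) hy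
      fun z hz => hder (n + 1) z hz).trans ?_
    calc M * (Nat.factorial (n + 1)) / R ^ (n + 1) * (y - c) ^ (n + 1) / (Nat.factorial n)
        = M * ((n + 1) * ((y - c) / R) ^ (n + 1)) := by
          rw [Nat.factorial_succ, div_pow]; push_cast; field_simp
      _ ≤ M * (2 ^ n * (1 / (4 * C)) ^ n) := by
          gcongr
          have h1 : (y - c) / R ≤ 1 / (4 * C) :=
            (div_le_div_of_nonneg_right (by linarith [hy.2]) hR0.le).trans hratio
          have h2 : 1 / (4 * C) ≤ 1 := by rw [div_le_one (by positivity)]; linarith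
          have h3 : 0 ≤ (y - c) / R := by positivity
          calc ((y - c) / R) ^ (n + 1) ≤ ((y - c) / R) ^ n :=
                pow_le_pow_of_le_one h3 (h1.trans h2) n.le_succ
            _ ≤ _ := by gcongr
      _ = M * (1 / (2 * C)) ^ n := by
          rw [← mul_pow]; congr 2; field_simp; norm_num
  obtain ⟨p, hp, hpf⟩ := exists_polynomial_eval_eq_taylorWithinEval f n (Icc c d) c
  have hpx := abs_eval_le_of_abs_eval_le_on hcd hδ hE hvol hp
    (B := M * η + M * (1 / (2 * C)) ^ n) (fun y hy => by
      have h1 := hrem y (hE hy)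
      rw [← hpf, abs_sub_comm] at h1
      have h2 := abs_sub_abs_le_abs_sub (p.eval y) (f y)
      linarith [hfE y hy]) hx
  rw [← hC] at hpx
  have hfx := hrem x hx
  rw [← hpf] at hfx
  have htri := abs_sub_abs_le_abs_sub (f x) (p.eval x)
  have hhalf : C ^ n * (1 / (2 * C)) ^ n = (1 / 2) ^ n := by
    rw [← mul_pow]; congr 1; field_simp
  have hsmall : (1 / (2 * C)) ^ n ≤ (1 / 2 : ℝ) ^ n := by
    refine pow_le_pow_left₀ (by positivity) ?_ n
    exact one_div_le_one_div_of_le two_pos (by linarith)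
  have hCη : 0 ≤ C ^ n * η := by positivity
  calc |f x| ≤ Real.exp 1 * C ^ n * (M * η + M * (1 / (2 * C)) ^ n) + M * (1 / (2 * C)) ^ n := by
        linarith
    _ = M * (Real.exp 1 * (C ^ n * η + (1 / 2) ^ n) + (1 / (2 * C)) ^ n) := by
        rw [← hhalf]; ring
    _ ≤ M * (Real.exp 1 * (3 * η ^ γ) + 3 * η ^ γ) := by
        gcongr; linarith
    _ = M * (3 * (Real.exp 1 + 1) * η ^ γ) := by ring

lemma iteratedDerivWithin_Icc_subset {f : ℝ → ℝ} {a b c d : ℝ} (hcd : c < d)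
    (hsub : Icc c d ⊆ Icc a b) (hf : ContDiffOn ℝ (⊤ : ℕ∞) f (Icc a b)) (k : ℕ) {x : ℝ}
    (hx : x ∈ Icc c d) :
    iteratedDerivWithin k f (Icc c d) x = iteratedDerivWithin k f (Icc a b) x := by
  have hab : a < b :=
    (hsub (left_mem_Icc.2 hcd.le)).1.trans_lt (hcd.trans_le (hsub (right_mem_Icc.2 hcd.le)).2)
  rw [iteratedDerivWithin, iteratedDerivWithin, iteratedFDerivWithin_subset hsub
    (uniqueDiffOn_Icc hcd) (uniqueDiffOn_Icc hab) (hf.of_le (mod_cast le_top)) hx]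

lemma exists_mem_Icc_of_mem_Icc_add_mul {a l x : ℝ} {m : ℕ} (hm : 0 < m)
    (hx : x ∈ Icc a (a + m * l)) : ∃ i < m, x ∈ Icc (a + i * l) (a + (i + 1 : ℕ) * l) := by
  induction m, hm using Nat.le_induction with
  | base => exact ⟨0, one_pos, by simpa using hx⟩
  | succ m _ ih =>
    rcases le_total x (a + m * l) with h | h
    · obtain ⟨i, hi, hxi⟩ := ih ⟨hx.1, h⟩
      exact ⟨i, hi.trans m.lt_succ_self, hxi⟩
    · exact ⟨m, m.lt_succ_self, h, hx.2⟩

/-- If an interval is cut into `m` equal pieces, a subset meets one of them in at least the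
average measure. -/
lemma exists_ofReal_le_volume_inter_Icc {a l v : ℝ} {m : ℕ} (hm : 0 < m) {E : Set ℝ}
    (hE : E ⊆ Icc a (a + m * l)) (hvol : ENNReal.ofReal (m * v) ≤ volume E) :
    ∃ i < m, ENNReal.ofReal v ≤ volume (E ∩ Icc (a + i * l) (a + (i + 1 : ℕ) * l)) := by
  have hcover : E ⊆ ⋃ i ∈ Finset.range m, E ∩ Icc (a + i * l) (a + (i + 1 : ℕ) * l) := by
    intro x hx
    obtain ⟨i, hi, hxi⟩ := exists_mem_Icc_of_mem_Icc_add_mul hm (hE hx)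
    exact mem_biUnion (Finset.mem_coe.2 (Finset.mem_range.2 hi)) ⟨hx, hxi⟩
  by_contra! hlt
  refine absurd (hvol.trans ((measure_mono hcover).trans (measure_biUnion_finset_le _ _)))
    (not_le.2 ((ENNReal.sum_lt_sum_of_nonempty (Finset.nonempty_range_iff.2 hm.ne') fun i hi =>
      hlt i (Finset.mem_range.1 hi)).trans_eq ?_))
  rw [Finset.sum_const, Finset.card_range, nsmul_eq_mul, ENNReal.ofReal_mul (by positivity),
    ENNReal.ofReal_natCast]

/-- Chaining a local propagation estimate along `m` adjacent intervals of length `l`. -/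
lemma abs_le_of_local_propagation {a l δ N γ M t : ℝ} {m j : ℕ} {f : ℝ → ℝ} {E : Set ℝ}
    (hl : 0 < l) (hδ : δ ≤ 1 / 2) (hN : 1 ≤ N) (hγ : γ ∈ Ioo (0 : ℝ) 1) (hM : 0 ≤ M) (ht : 0 < t)
    (hloc : ∀ (c d t : ℝ) (E : Set ℝ), c < d → Icc c d ⊆ Icc a (a + m * l) → d - c ≤ 2 * l →
      0 < t → E ⊆ Icc c d → ENNReal.ofReal (δ * (d - c)) ≤ volume E →
      (∀ x ∈ E, |f x| ≤ M * t) → ∀ x ∈ Icc c d, |f x| ≤ M * (N * t ^ γ))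
    (hj : j < m) (hE : E ⊆ Icc (a + j * l) (a + (j + 1 : ℕ) * l))
    (hvol : ENNReal.ofReal (δ * l) ≤ volume E) (hfE : ∀ x ∈ E, |f x| ≤ M * t) (k : ℕ) :
    ∀ i < m, i ≤ j + k → j ≤ i + k → ∀ x ∈ Icc (a + i * l) (a + (i + 1 : ℕ) * l),
      |f x| ≤ M * (N ^ (k + 1) * t ^ (γ ^ (k + 1))) := by
  have hmono : ∀ {p q : ℕ}, p ≤ q → a + p * l ≤ a + q * l := fun h => by gcongr
  have hIcc : ∀ {p q : ℕ}, q ≤ m → Icc (a + p * l) (a + q * l) ⊆ Icc a (a + m * l) :=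
    fun h => Icc_subset_Icc (le_add_of_nonneg_right (by positivity)) (hmono h)
  induction k with
  | zero =>
    intro i hi h1 h2
    obtain rfl : i = j := by omega
    simp only [zero_add, pow_one]
    have hlen : a + (i + 1 : ℕ) * l - (a + i * l) = l := by push_cast; ring
    exact hloc _ _ t E (by linarith) (hIcc hj) (by linarith) ht hE (by rwa [hlen]) hfE
  | succ k ih =>
    intro i hi h1 h2 x hx
    obtain ⟨i', p, q, hi', h1', h2', hpq, hq, hqm, hpi, hiq, hpi', hiq'⟩ : ∃ i' p q : ℕ, i' < m ∧
        i' ≤ j + k ∧ j ≤ i' + k ∧ p < q ∧ q ≤ p + 2 ∧ q ≤ m ∧ p ≤ i ∧ i + 1 ≤ q ∧ p ≤ i' ∧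
        i' + 1 ≤ q := by
      rcases lt_trichotomy i j with h | h | h
      · exact ⟨i + 1, i, i + 2, by omega⟩
      · exact ⟨i, i, i + 1, by omega⟩
      · exact ⟨i - 1, i - 1, i + 1, by omega⟩
    have hlt : a + p * l < a + q * l := by gcongr
    have hlen : a + q * l - (a + p * l) ≤ 2 * l := by
      have : (q : ℝ) ≤ p + 2 := by exact_mod_cast hq
      nlinarith
    have hN0 : 0 < N := by linarith
    have hNk : 1 ≤ N ^ (k + 1) := one_le_pow₀ hN
    have hvol' : ENNReal.ofReal (δ * (a + q * l - (a + p * l))) ≤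
        volume (Icc (a + i' * l) (a + (i' + 1 : ℕ) * l)) := by
      rw [Real.volume_Icc]
      refine ENNReal.ofReal_le_ofReal ?_
      push_cast
      nlinarith
    refine (hloc _ _ (N ^ (k + 1) * t ^ (γ ^ (k + 1))) _ hlt (hIcc hqm) hlen (by positivity)
      (Icc_subset_Icc (hmono hpi') (hmono hiq')) hvol' (ih i' hi' h1' h2') x
      ⟨(hmono hpi).trans hx.1, hx.2.trans (hmono hiq)⟩).trans ?_
    have hNγ : (N ^ (k + 1)) ^ γ ≤ N ^ (k + 1) :=
      (Real.rpow_le_rpow_of_exponent_le hNk hγ.2.le).trans_eq (Real.rpow_one _)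
    rw [Real.mul_rpow (by positivity) (by positivity), ← Real.rpow_mul ht.le, ← pow_succ,
      ← mul_assoc N, pow_succ' N (k + 1)]
    have := Real.rpow_nonneg ht.le (γ ^ (k + 1 + 1))
    gcongr

/-- Markov's inequality for the sublevel set at twice a strict upper bound of the average. -/
lemma ofReal_half_le_volume_inter_sublevel {f : ℝ → ℝ} {F : Set ℝ} {v T : ℝ}
    (hF : MeasurableSet F) (hint : IntegrableOn (fun x => |f x|) F) (hv : 0 < v)
    (hvol : volume F = ENNReal.ofReal v) (hT : (∫ x in F, |f x|) / v < T) :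
    ENNReal.ofReal (v / 2) ≤ volume (F ∩ {x | |f x| ≤ 2 * T}) := by
  have hI : 0 ≤ ∫ x in F, |f x| := integral_nonneg fun _ => abs_nonneg _
  have hT0 : 0 < T := (div_nonneg hI hv.le).trans_lt hT
  rw [div_lt_iff₀ hv] at hT
  have hmarkov := mul_meas_ge_le_integral_of_nonneg (Filter.Eventually.of_forall fun x =>
    abs_nonneg (f x)) hint (2 * T)
  rw [measureReal_def, Measure.restrict_apply' hF] at hmarkov
  have hfin : ∀ s : Set ℝ, s ⊆ F → volume s ≠ ⊤ := fun s hs =>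
    ((measure_mono hs).trans_lt (hvol ▸ ENNReal.ofReal_lt_top)).ne
  have hsub : F ⊆ (F ∩ {x | |f x| ≤ 2 * T}) ∪ ({x | 2 * T ≤ |f x|} ∩ F) := fun x hx =>
    (le_total (|f x|) (2 * T)).imp (fun h => ⟨hx, h⟩) (fun h => ⟨h, hx⟩)
  have h1 := hfin _ (inter_subset_left (s := F) (t := {x | |f x| ≤ 2 * T}))
  have h2 := hfin _ (inter_subset_right (s := {x | 2 * T ≤ |f x|}) (t := F))
  have hle := ENNReal.toReal_mono (ENNReal.add_ne_top.2 ⟨h1, h2⟩)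
    ((measure_mono hsub).trans (measure_union_le _ _))
  rw [ENNReal.toReal_add h1 h2, hvol, ENNReal.toReal_ofReal hv.le] at hle
  rw [ENNReal.ofReal_le_iff_le_toReal h1]
  have : (volume ({x | 2 * T ≤ |f x|} ∩ F)).toReal ≤ v / 2 := by
    by_contra! h
    nlinarith
  linarith

/-- Lemma 4.4: propagation of smallness from measurable sets for
functions with quantitative analyticity bounds on an interval. -/
theorem stmt_9 (ρ κ : ℝ) (hρ : ρ ∈ Set.Ioc (0 : ℝ) 1) (hκ : 0 < κ) :
    ∃ N γ : ℝ, 0 < N ∧ γ ∈ Set.Ioo (0 : ℝ) 1 ∧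
      ∀ (a L M : ℝ) (f : ℝ → ℝ) (F : Set ℝ),
        0 < L → 0 < M →
        ContDiffOn ℝ (⊤ : ℕ∞) f (Icc a (a + L)) →
        (∀ k : ℕ, ∀ x ∈ Icc a (a + L),
          |iteratedDerivWithin k f (Icc a (a + L)) x|
            ≤ M * (Nat.factorial k) / (2 * ρ * L) ^ k) →
        MeasurableSet F → F ⊆ Icc a (a + L) →
        volume F = ENNReal.ofReal (κ * L) →
        ∀ x ∈ Icc a (a + L),
          |f x| ≤ N * ((∫ τ in F, |f τ|) / (κ * L)) ^ γ * M ^ (1 - γ) := by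
  obtain ⟨δ, hδ⟩ : ∃ δ : ℝ, δ = min (κ / 2) (1 / 2) := ⟨_, rfl⟩
  have hδ0 : 0 < δ := by rw [hδ]; positivity
  have hδκ : δ ≤ κ / 2 := hδ ▸ min_le_left _ _
  have hδ2 : δ ≤ 1 / 2 := hδ ▸ min_le_right _ _
  obtain ⟨θ, N, γ, hθ, hN, hγ, hloc⟩ := exists_local_propagation hδ0 (by linarith)
  have hρ0 := hρ.1
  have hN0 : 0 < N := by linarith
  obtain ⟨n, hn⟩ := exists_nat_one_div_lt (mul_pos hθ hρ0)
  rw [← Nat.cast_succ] at hn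
  obtain ⟨m, hm⟩ : ∃ m, m = n.succ := ⟨_, rfl⟩
  rw [← hm] at hn
  have hm0 : 0 < m := hm ▸ n.succ_pos
  have hmR : (0 : ℝ) < m := by exact_mod_cast hm0
  obtain ⟨β, hβ⟩ : ∃ β : ℝ, β = γ ^ (m + 1) := ⟨_, rfl⟩
  have hβ0 : 0 < β := hβ ▸ pow_pos hγ.1 _
  have hβ1 : β < 1 := hβ ▸ pow_lt_one₀ hγ.1.le hγ.2 m.succ_ne_zero
  refine ⟨N ^ (m + 1) * 2 ^ β, β, by positivity, ⟨hβ0, hβ1⟩, ?_⟩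
  intro a L M f F hL hM hf hder hF hFsub hvol x hx
  obtain ⟨l, hl⟩ : ∃ l : ℝ, l = L / m := ⟨_, rfl⟩
  have hl0 : 0 < l := by rw [hl]; positivity
  have hml : (m : ℝ) * l = L := by rw [hl]; field_simp
  have hlθ : 2 * l ≤ θ * (2 * ρ * L) := by
    have : l = 1 / m * L := by rw [hl]; ring
    rw [this]
    nlinarith
  have hint : IntegrableOn (fun x => |f x|) F :=
    (hf.continuousOn.abs.integrableOn_Icc).mono_set hFsub
  have havg : 0 ≤ (∫ τ in F, |f τ|) / (κ * L) :=
    div_nonneg (integral_nonneg fun _ => abs_nonneg _) (by positivity)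
  have hbound : ∀ T, (∫ τ in F, |f τ|) / (κ * L) < T →
      |f x| ≤ N ^ (m + 1) * 2 ^ β * T ^ β * M ^ (1 - β) := by
    intro T hT
    have hT0 : 0 < T := havg.trans_lt hT
    have hE := ofReal_half_le_volume_inter_sublevel hF hint (by positivity) hvol hT
    obtain ⟨j, hj, hEj⟩ := exists_ofReal_le_volume_inter_Icc (a := a) (l := l) (v := δ * l) hm0
      (inter_subset_left.trans (hml.symm ▸ hFsub)) ((ENNReal.ofReal_le_ofReal (by
        rw [← hml]; nlinarith [mul_pos hmR hl0])).trans hE)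
    obtain ⟨i, hi, hxi⟩ := exists_mem_Icc_of_mem_Icc_add_mul hm0 (hml.symm ▸ hx)
    have hres := abs_le_of_local_propagation (t := 2 * T / M) (f := f) hl0 hδ2 hN hγ hM.le
      (by positivity) (fun c d t E hcd hsub hlen ht hE hvE hfE => by
        rw [hml] at hsub
        exact hloc c d (2 * ρ * L) M t f E hcd (hlen.trans hlθ) hM ht (hf.mono hsub)
          (fun k y hy => by
            rw [iteratedDerivWithin_Icc_subset hcd hsub hf k hy]
            exact hder k y (hsub hy)) hE hvE hfE)
      hj inter_subset_right hEj
      (fun y hy => by rw [mul_div_cancel₀ _ hM.ne']; exact hy.1.2) m i hi (by omega) (by omega) x hxi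
    refine hres.trans_eq ?_
    rw [← hβ, Real.div_rpow (by positivity) hM.le, Real.mul_rpow zero_le_two hT0.le,
      Real.rpow_sub hM, Real.rpow_one]
    ring
  have hcont : Filter.Tendsto (fun T : ℝ => N ^ (m + 1) * 2 ^ β * T ^ β * M ^ (1 - β))
      (nhdsWithin ((∫ τ in F, |f τ|) / (κ * L)) (Ioi ((∫ τ in F, |f τ|) / (κ * L))))
      (nhds (N ^ (m + 1) * 2 ^ β * ((∫ τ in F, |f τ|) / (κ * L)) ^ β * M ^ (1 - β))) :=
    (((Real.continuous_rpow_const hβ0.le).const_mul _).mul_const _).continuousAt.tendsto.mono_left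
      nhdsWithin_le_nhds
  exact ge_of_tendsto hcont (Filter.eventually_of_mem self_mem_nhdsWithin hbound)
end

section
/- Let f : B_{2R} ⊆ ℝⁿ → ℝ satisfy |∂^α f(x)| ≤ M |α|! (ρR)^{−|α|} for all x ∈ B_{2R} and multi-indices α, for some M > 0 and ρ ∈ (0,1]. Let E ⊆ B_R be measurable with |E| > 0. Then there exist N and θ ∈ (0,1), depending only on ρ and |E|/|B_R|, such that ‖f‖_{L^∞(B_R)} ≤ N (⨍_E |f| dx)^θ M^{1−θ}. -/
open MeasureTheory Set

theorem exists_separated_of_lt_volume {δ : ℝ} (hδ : 0 < δ) (k : ℕ) {F : Set ℝ}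
    (hF : BddBelow F) (h : ENNReal.ofReal (k * δ) < volume F) :
    ∃ t : ℕ → ℝ, (∀ i ≤ k, t i ∈ F) ∧ ∀ i < k, t i + δ ≤ t (i + 1) := by
  induction k generalizing F with
  | zero =>
    obtain ⟨x, hx⟩ := nonempty_of_measure_ne_zero (ne_bot_of_gt h)
    exact ⟨fun _ => x, fun _ _ => hx, fun i hi => absurd hi (Nat.not_lt_zero i)⟩
  | succ k ih =>
    have hne : F.Nonempty := nonempty_of_measure_ne_zero (ne_bot_of_gt h)
    obtain ⟨r, hr0, hr1, hr2⟩ := ENNReal.lt_iff_exists_real_btwn.1 h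
    have hr : ((k + 1 : ℕ) : ℝ) * δ < r :=
      (ENNReal.ofReal_lt_ofReal_iff_of_nonneg (by positivity)).1 hr1
    push_cast at hr
    obtain ⟨x, hx, hxs⟩ := exists_lt_of_csInf_lt hne
      (show sInf F < sInf F + (r - (k + 1) * δ) by linarith)
    have hG : ENNReal.ofReal (k * δ) < volume (F ∩ Ici (x + δ)) := by
      by_contra! hcon
      have h1 : volume F ≤ volume (Icc (sInf F) (x + δ)) + volume (F ∩ Ici (x + δ)) := by
        refine (measure_mono fun y hy => ?_).trans (measure_union_le _ _)
        rcases le_total y (x + δ) with hyx | hyx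
        · exact Or.inl ⟨csInf_le hF hy, hyx⟩
        · exact Or.inr ⟨hy, hyx⟩
      have h2 : volume F ≤ ENNReal.ofReal r := by
        refine h1.trans ((add_le_add le_rfl hcon).trans ?_)
        have : sInf F ≤ x := csInf_le hF hx
        rw [Real.volume_Icc, ← ENNReal.ofReal_add (by linarith) (by positivity)]
        exact ENNReal.ofReal_le_ofReal (by linarith)
      exact absurd hr2 (not_lt.2 h2)
    obtain ⟨t, ht, hts⟩ := ih (hF.mono inter_subset_left) hG
    refine ⟨fun i => Nat.casesOn i x t, fun i hi => ?_, fun i hi => ?_⟩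
    · cases i with
      | zero => exact hx
      | succ i => exact (ht i (by omega)).1
    · cases i with
      | zero => exact (ht 0 (by omega)).2
      | succ i => exact hts i (by omega)

theorem nat_sub_mul_le_of_separated {δ : ℝ} {k : ℕ} {t : ℕ → ℝ}
    (ht : ∀ i < k, t i + δ ≤ t (i + 1)) {i j : ℕ} (hij : i ≤ j) (hj : j ≤ k) :
    ((j - i : ℕ) : ℝ) * δ ≤ t j - t i := by
  induction j, hij using Nat.le_induction with
  | base => simp
  | succ j hij ih =>
    have h1 := ih (by omega)
    have h2 := ht j (by omega)
    rw [Nat.succ_sub hij]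
    push_cast
    linarith

theorem factorial_mul_pow_le_prod_of_separated {δ : ℝ} (hδ : 0 ≤ δ) {k : ℕ} {t : ℕ → ℝ}
    (ht : ∀ i < k, t i + δ ≤ t (i + 1)) {i : ℕ} (hi : i ≤ k) :
    (i.factorial * (k - i).factorial : ℝ) * δ ^ k ≤
      ∏ j ∈ (Finset.range (k + 1)).erase i, |t i - t j| := by
  have hsplit : (Finset.range (k + 1)).erase i = Finset.range i ∪ Finset.Ico (i + 1) (k + 1) := by
    ext j; simp; omega
  have hdisj : Disjoint (Finset.range i) (Finset.Ico (i + 1) (k + 1)) := by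
    rw [Finset.disjoint_left]; intro j; simp; omega
  rw [hsplit, Finset.prod_union hdisj]
  have h1 : (i.factorial : ℝ) * δ ^ i ≤ ∏ j ∈ Finset.range i, |t i - t j| := by
    rw [← Finset.prod_range_reflect]
    have : (i.factorial : ℝ) * δ ^ i = ∏ j ∈ Finset.range i, (((j + 1 : ℕ) : ℝ) * δ) := by
      rw [Finset.prod_mul_distrib, Finset.prod_const, Finset.card_range, ← Nat.cast_prod,
        Finset.prod_range_add_one_eq_factorial]
    rw [this]
    refine Finset.prod_le_prod (fun j _ => by positivity) fun j hj => ?_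
    have hj' := Finset.mem_range.1 hj
    have := nat_sub_mul_le_of_separated ht (show i - 1 - j ≤ i by omega) hi
    rw [show i - (i - 1 - j) = j + 1 by omega] at this
    exact this.trans (le_abs_self _)
  have h2 : ((k - i).factorial : ℝ) * δ ^ (k - i) ≤
      ∏ j ∈ Finset.Ico (i + 1) (k + 1), |t i - t j| := by
    rw [Finset.prod_Ico_eq_prod_range, show k + 1 - (i + 1) = k - i by omega]
    have : ((k - i).factorial : ℝ) * δ ^ (k - i) =
        ∏ j ∈ Finset.range (k - i), (((j + 1 : ℕ) : ℝ) * δ) := by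
      rw [Finset.prod_mul_distrib, Finset.prod_const, Finset.card_range, ← Nat.cast_prod,
        Finset.prod_range_add_one_eq_factorial]
    rw [this]
    refine Finset.prod_le_prod (fun j _ => by positivity) fun j hj => ?_
    have hj' := Finset.mem_range.1 hj
    have := nat_sub_mul_le_of_separated ht (show i ≤ i + 1 + j by omega) (by omega)
    rw [show i + 1 + j - i = j + 1 by omega] at this
    rw [abs_sub_comm]
    exact this.trans (le_abs_self _)
  calc (i.factorial * (k - i).factorial : ℝ) * δ ^ k
      = (i.factorial * δ ^ i) * ((k - i).factorial * δ ^ (k - i)) := by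
        rw [← Nat.add_sub_cancel' hi, pow_add]
        simp only [Nat.add_sub_cancel' hi]; ring
    _ ≤ _ := mul_le_mul h1 h2 (by positivity) (Finset.prod_nonneg fun _ _ => abs_nonneg _)

theorem abs_eval_lagrange_basis_le_of_separated {δ L x : ℝ} (hδ : 0 < δ) {k : ℕ} {t : ℕ → ℝ}
    (ht : ∀ i < k, t i + δ ≤ t (i + 1)) (hx : ∀ i ≤ k, |x - t i| ≤ L) {i : ℕ} (hi : i ≤ k) :
    |(Lagrange.basis (Finset.range (k + 1)) t i).eval x| ≤ (2 * L / δ) ^ k / k.factorial := by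
  have hL : 0 ≤ L := (abs_nonneg _).trans (hx 0 (Nat.zero_le k))
  have hprod := factorial_mul_pow_le_prod_of_separated hδ.le ht hi
  have heval : |(Lagrange.basis (Finset.range (k + 1)) t i).eval x| =
      (∏ j ∈ (Finset.range (k + 1)).erase i, |x - t j|) /
        ∏ j ∈ (Finset.range (k + 1)).erase i, |t i - t j| := by
    rw [Lagrange.basis, Polynomial.eval_prod, Finset.abs_prod, ← Finset.prod_div_distrib]
    refine Finset.prod_congr rfl fun j _ => ?_
    simp [Lagrange.basisDivisor, abs_mul, abs_inv, div_eq_inv_mul]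
  have hnum : ∏ j ∈ (Finset.range (k + 1)).erase i, |x - t j| ≤ L ^ k := by
    refine (Finset.prod_le_prod (g := fun _ => L) (fun _ _ => abs_nonneg _) fun j hj => ?_).trans_eq ?_
    · exact hx j (by have := Finset.mem_range.1 (Finset.mem_of_mem_erase hj); omega)
    · rw [Finset.prod_const, Finset.card_erase_of_mem (by simp; omega), Finset.card_range,
        Nat.add_sub_cancel]
  have hchoose : (k.factorial : ℝ) ≤ 2 ^ k * (i.factorial * (k - i).factorial) := by
    rw [← Nat.choose_mul_factorial_mul_factorial hi, mul_assoc]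
    push_cast
    gcongr
    exact_mod_cast Nat.choose_le_two_pow k i
  rw [heval]
  have hpos : 0 < (i.factorial * (k - i).factorial : ℝ) * δ ^ k := by positivity
  calc _ ≤ L ^ k / ((i.factorial * (k - i).factorial : ℝ) * δ ^ k) :=
        div_le_div₀ (by positivity) hnum hpos hprod
    _ ≤ (2 * L / δ) ^ k / k.factorial := by
        rw [div_le_div_iff₀ hpos (by positivity), div_pow, mul_pow]
        calc L ^ k * k.factorial ≤ L ^ k * (2 ^ k * (i.factorial * (k - i).factorial)) := by gcongr
          _ = _ := by field_simp

/-- `g` is approximated on subintervals of `J` by polynomials, to every order at the left endpoint,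
as a smooth function with `|g⁽ᵏ⁾| ≤ k!` is by its Taylor polynomials. -/
def HasTaylorApprox (g : ℝ → ℝ) (J : Set ℝ) : Prop :=
  ∀ a ∈ J, ∀ b ∈ J, a ≤ b → ∀ k : ℕ, ∃ P : Polynomial ℝ, P.degree < k ∧
    ∀ s ∈ Icc a b, |g s - P.eval s| ≤ (2 * (s - a)) ^ k

theorem HasTaylorApprox.abs_le_one {g : ℝ → ℝ} {J : Set ℝ} (hg : HasTaylorApprox g J) {a : ℝ}
    (ha : a ∈ J) : |g a| ≤ 1 := by
  obtain ⟨P, hP, h⟩ := hg a ha a ha le_rfl 0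
  have : P = 0 := Polynomial.degree_eq_bot.1 (by simpa [Nat.WithBot.lt_zero_iff] using hP)
  simpa [this] using h a (by simp)

theorem HasTaylorApprox.abs_le_pow_mul_add {g : ℝ → ℝ} {J F : Set ℝ} (hg : HasTaylorApprox g J)
    {c a ε : ℝ} (hc : 0 < c) (hc1 : c ≤ 1) (ha : a ∈ J) (hFJ : F ⊆ J)
    (hF : F ⊆ Icc a (a + 2 * (c / 192))) (hvol : ENNReal.ofReal (c * (c / 192)) ≤ volume F)
    (hε : 0 ≤ ε) (hgF : ∀ s ∈ F, |g s| ≤ ε) (k : ℕ) :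
    |g a| ≤ (24 / c) ^ k * ε + (1 / 2) ^ k := by
  cases k with
  | zero => simpa using (hg.abs_le_one ha).trans (by linarith)
  | succ m =>
    set δ := c / 192 with hδ
    have hδ0 : 0 < δ := by positivity
    have hh : 0 < c * δ / (m + 1) := by positivity
    obtain ⟨t, htF, ht⟩ := exists_separated_of_lt_volume hh m (F := F)
      ⟨a, fun y hy => (hF hy).1⟩ (lt_of_lt_of_le (by
        rw [ENNReal.ofReal_lt_ofReal_iff_of_nonneg (by positivity), mul_div_assoc', div_lt_iff₀
          (by positivity)]
        nlinarith [mul_pos hc hδ0]) hvol)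
    have hmono : ∀ i ≤ m, t i ≤ t m := fun i hi => by
      have := nat_sub_mul_le_of_separated ht hi le_rfl
      have : 0 ≤ ((m - i : ℕ) : ℝ) * (c * δ / (m + 1)) := by positivity
      linarith
    obtain ⟨P, hPdeg, hP⟩ := hg a ha (t m) (hFJ (htF m le_rfl)) (hF (htF m le_rfl)).1 (m + 1)
    have hPa : g a = P.eval a := by
      have := hP a ⟨le_rfl, (hF (htF m le_rfl)).1⟩
      rw [sub_self, mul_zero, zero_pow (Nat.succ_ne_zero m)] at this
      exact sub_eq_zero.1 (abs_nonpos_iff.1 this)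
    have hPt : ∀ i ≤ m, |P.eval (t i)| ≤ ε + (4 * δ) ^ (m + 1) := fun i hi => by
      have h1 := hP (t i) ⟨(hF (htF i hi)).1, hmono i hi⟩
      have h2 := hgF _ (htF i hi)
      have h3 : (2 * (t i - a)) ^ (m + 1) ≤ (4 * δ) ^ (m + 1) := by
        have := hF (htF i hi)
        exact pow_le_pow_left₀ (by linarith [this.1]) (by linarith [this.2]) _
      have h4 := abs_sub_abs_le_abs_sub (P.eval (t i)) (g (t i))
      rw [abs_sub_comm] at h4
      linarith
    have hinj : Set.InjOn t (Finset.range (m + 1)) := by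
      have hlt : ∀ i j, i < j → j ≤ m → t i < t j := fun i j hij hj => by
        have h1 := nat_sub_mul_le_of_separated ht hij.le hj
        have : (0 : ℝ) < ((j - i : ℕ) : ℝ) := by exact_mod_cast Nat.sub_pos_of_lt hij
        have : 0 < ((j - i : ℕ) : ℝ) * (c * δ / (m + 1)) := by positivity
        linarith
      intro i hi j hj hij
      simp only [Finset.coe_range, Set.mem_Iio] at hi hj
      rcases lt_trichotomy i j with h | h | h
      · exact absurd hij (hlt i j h (by omega)).ne
      · exact h
      · exact absurd hij.symm (hlt j i h (by omega)).ne
    have hPsum : P.eval a = ∑ i ∈ Finset.range (m + 1),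
        P.eval (t i) * (Lagrange.basis (Finset.range (m + 1)) t i).eval a := by
      conv_lhs => rw [Lagrange.eq_interpolate (f := P) hinj (by simpa using hPdeg)]
      simp [Lagrange.interpolate_apply, Polynomial.eval_finsetSum]
    have hbasis : ∀ i ≤ m, |(Lagrange.basis (Finset.range (m + 1)) t i).eval a| ≤
        (12 / c) ^ (m + 1) := fun i hi => by
      refine (abs_eval_lagrange_basis_le_of_separated (L := 2 * δ) hh ht (fun j hj => ?_) hi).trans ?_
      · have := hF (htF j hj)
        rw [abs_sub_comm, abs_of_nonneg (by linarith [this.1])]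
        linarith [this.2]
      · have h1 : 2 * (2 * δ) / (c * δ / (m + 1)) = 4 / c * ((m + 1 : ℕ) : ℝ) := by
          push_cast; field_simp; ring
        have h2 : ((m + 1 : ℕ) : ℝ) ^ m / m.factorial =
            ((m + 1 : ℕ) : ℝ) ^ (m + 1) / (m + 1).factorial := by
          rw [Nat.factorial_succ, pow_succ]; push_cast; field_simp
        have h3 : ((m + 1 : ℕ) : ℝ) ^ (m + 1) / (m + 1).factorial ≤ 3 ^ (m + 1) := by
          refine (Real.pow_div_factorial_le_exp _ (by positivity) _).trans ?_
          rw [← Real.exp_one_pow]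
          exact pow_le_pow_left₀ (Real.exp_pos 1).le (by linarith [Real.exp_one_lt_d9]) _
        have h4 : (4 / c) ^ m ≤ (4 / c) ^ (m + 1) :=
          pow_le_pow_right₀ (by rw [le_div_iff₀ hc]; linarith) (Nat.le_succ m)
        rw [h1, mul_pow, mul_div_assoc, h2]
        calc _ ≤ (4 / c) ^ (m + 1) * 3 ^ (m + 1) := by gcongr
          _ = (12 / c) ^ (m + 1) := by rw [← mul_pow]; congr 1; ring
    have htwo : ((m + 1 : ℕ) : ℝ) ≤ 2 ^ (m + 1) := by exact_mod_cast (Nat.lt_two_pow_self).le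
    calc |g a| ≤ ∑ i ∈ Finset.range (m + 1), (ε + (4 * δ) ^ (m + 1)) * (12 / c) ^ (m + 1) := by
          rw [hPa, hPsum]
          refine (Finset.abs_sum_le_sum_abs _ _).trans (Finset.sum_le_sum fun i hi => ?_)
          have hi' : i ≤ m := Nat.lt_succ_iff.1 (Finset.mem_range.1 hi)
          rw [abs_mul]
          exact mul_le_mul (hPt i hi') (hbasis i hi') (abs_nonneg _) (by positivity)
      _ = ((m + 1 : ℕ) : ℝ) * ((ε + (4 * δ) ^ (m + 1)) * (12 / c) ^ (m + 1)) := by simp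
      _ ≤ 2 ^ (m + 1) * ((ε + (4 * δ) ^ (m + 1)) * (12 / c) ^ (m + 1)) := by gcongr
      _ = (2 * (12 / c)) ^ (m + 1) * ε + (2 * (4 * δ) * (12 / c)) ^ (m + 1) := by
          simp only [mul_pow]; ring
      _ = _ := by
          congr 2
          · congr 1; ring
          · rw [hδ]; field_simp; norm_num

theorem logb_two_mul_two_mem_Ioo {A : ℝ} (hA : 1 < A) :
    Real.logb (2 * A) 2 ∈ Ioo (0 : ℝ) 1 := by
  refine ⟨Real.logb_pos (by linarith) one_lt_two, ?_⟩
  rw [Real.logb_lt_iff_lt_rpow (by linarith) two_pos, Real.rpow_one]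
  linarith

theorem le_four_mul_rpow_logb {A ε y : ℝ} (hA : 1 < A) (hε : 0 < ε) (hy : y ≤ 1)
    (h : ∀ k : ℕ, y ≤ A ^ k * ε + (1 / 2) ^ k) : y ≤ 4 * ε ^ Real.logb (2 * A) 2 := by
  have hA0 : 0 < 2 * A := by linarith
  have hθ : 0 < Real.logb (2 * A) 2 := (logb_two_mul_two_mem_Ioo hA).1
  rcases lt_or_ge 1 ε with h1 | h1
  · linarith [Real.one_le_rpow h1.le hθ.le]
  obtain ⟨k, hk1, hk2⟩ := exists_nat_pow_near (one_le_inv_iff₀.2 ⟨hε, h1⟩)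
    (show 1 < 2 * A by linarith)
  have hk3 : A ^ k * ε ≤ (1 / 2) ^ k := by
    have : (2 * A) ^ k * ε ≤ 1 := by
      calc _ ≤ ε⁻¹ * ε := by gcongr
        _ = 1 := inv_mul_cancel₀ hε.ne'
    rw [mul_pow] at this
    rw [one_div, inv_pow, le_inv_comm₀ (by positivity) (by positivity), ← one_div,
      le_div_iff₀ (by positivity)]
    linarith
  have hk4 : (1 / 2 : ℝ) ^ (k + 1) ≤ ε ^ Real.logb (2 * A) 2 := by
    have h2 : ((2 * A) ^ (k + 1))⁻¹ ≤ ε := (inv_le_comm₀ (by positivity) hε).2 hk2.le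
    refine le_trans (le_of_eq ?_) (Real.rpow_le_rpow (by positivity) h2 hθ.le)
    rw [Real.inv_rpow (by positivity), ← Real.rpow_pow_comm hA0.le,
      Real.rpow_logb hA0 (by linarith) two_pos, one_div, inv_pow]
  have := h k
  rw [pow_succ] at hk4
  linarith

theorem HasTaylorApprox.abs_zero_le_of_subset_Icc {g : ℝ → ℝ} {J : Set ℝ}
    (hg : HasTaylorApprox g J) (hJ : J.OrdConnected) (h0 : (0 : ℝ) ∈ J) {c : ℝ} (hc : 0 < c)
    (hc1 : c ≤ 1) (j : ℕ) {F : Set ℝ} {ε : ℝ} (hFJ : F ⊆ J)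
    (hF : F ⊆ Icc (j * (c / 192)) ((j + 1) * (c / 192)))
    (hvol : ENNReal.ofReal (c * (c / 192)) ≤ volume F) (hε : 0 < ε) (hgF : ∀ s ∈ F, |g s| ≤ ε) :
    |g 0| ≤ 4 ^ (j + 1) * ε ^ (Real.logb (2 * (24 / c)) 2 ^ (j + 1)) := by
  have hA : 1 < 24 / c := by rw [lt_div_iff₀ hc]; linarith
  have hδ : 0 < c / 192 := by positivity
  obtain ⟨hθ0, hθ1⟩ := logb_two_mul_two_mem_Ioo hA
  set θ := Real.logb (2 * (24 / c)) 2
  induction j generalizing F ε with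
  | zero =>
    rw [zero_add, pow_one, pow_one]
    refine le_four_mul_rpow_logb hA hε (hg.abs_le_one h0) fun k =>
      hg.abs_le_pow_mul_add hc hc1 h0 hFJ (fun s hs => ?_) hvol hε.le hgF k
    have := hF hs
    simp only [Nat.cast_zero, zero_mul, zero_add, one_mul, mem_Icc] at this ⊢
    exact ⟨this.1, by linarith [this.2]⟩
  | succ j ih =>
    push_cast at hF
    obtain ⟨p, hp⟩ : F.Nonempty := nonempty_of_measure_ne_zero
      (ne_bot_of_gt ((ENNReal.ofReal_pos.2 (by positivity)).trans_le hvol))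
    have hsub : Icc (j * (c / 192)) ((j + 1) * (c / 192)) ⊆ J := fun s hs =>
      hJ.out h0 (hFJ hp) ⟨le_trans (by positivity) hs.1, hs.2.trans (hF hp).1⟩
    have hstep := ih (ε := 4 * ε ^ θ) hsub le_rfl (by
        rw [Real.volume_Icc]
        exact ENNReal.ofReal_le_ofReal (by nlinarith)) (by positivity) fun a ha =>
      le_four_mul_rpow_logb hA hε (hg.abs_le_one (hsub ha)) fun k =>
        hg.abs_le_pow_mul_add hc hc1 (hsub ha) hFJ (fun s hs =>
          ⟨ha.2.trans (hF hs).1, by linarith [(hF hs).2, ha.1]⟩) hvol hε.le hgF k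
    refine hstep.trans ?_
    rw [Real.mul_rpow (by norm_num) (by positivity), ← Real.rpow_mul hε.le, pow_succ' θ (j + 1),
      pow_succ (4 : ℝ) (j + 1), mul_assoc]
    gcongr
    calc (4 : ℝ) ^ θ ^ (j + 1) ≤ 4 ^ (1 : ℝ) :=
          Real.rpow_le_rpow_of_exponent_le (by norm_num) (pow_le_one₀ hθ0.le hθ1.le)
      _ = 4 := Real.rpow_one 4

theorem exists_abs_zero_le_mul_rpow {S m : ℝ} (hS : 0 < S) (hm : 0 < m) :
    ∃ N θ : ℝ, 0 < N ∧ θ ∈ Ioo (0 : ℝ) 1 ∧ ∀ (g : ℝ → ℝ) (J F : Set ℝ) (ε : ℝ),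
      HasTaylorApprox g J → J.OrdConnected → (0 : ℝ) ∈ J → F ⊆ J → F ⊆ Icc 0 S →
      ENNReal.ofReal m ≤ volume F → 0 < ε → (∀ s ∈ F, |g s| ≤ ε) → |g 0| ≤ N * ε ^ θ := by
  obtain ⟨c, hc, hc1, hcm⟩ : ∃ c : ℝ, 0 < c ∧ c ≤ 1 ∧ (S + 1) * c < m := by
    refine ⟨min 1 (m / (S + 2)), by positivity, min_le_left _ _, ?_⟩
    have h1 : min 1 (m / (S + 2)) ≤ m / (S + 2) := min_le_right _ _
    have h2 : (S + 1) * (m / (S + 2)) < m := by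
      rw [mul_div_assoc', div_lt_iff₀ (by positivity)]; nlinarith
    nlinarith
  have hA : 1 < 24 / c := by rw [lt_div_iff₀ hc]; linarith
  have hδ : 0 < c / 192 := by positivity
  obtain ⟨hθ0, hθ1⟩ := logb_two_mul_two_mem_Ioo hA
  set θ := Real.logb (2 * (24 / c)) 2
  set K := ⌊S / (c / 192)⌋₊ + 1 with hK
  have hKS : K * (c / 192) ≤ S + 1 := by
    have h1 := Nat.floor_le (show 0 ≤ S / (c / 192) by positivity)
    rw [le_div_iff₀ hδ] at h1
    rw [hK]; push_cast; linarith
  refine ⟨4 ^ K, θ ^ K, by positivity, ⟨by positivity, pow_lt_one₀ hθ0.le hθ1 (by omega)⟩, ?_⟩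
  intro g J F ε hg hJ h0 hFJ hFS hvol hε hgF
  have hKθ : (0 : ℝ) < θ ^ K := by positivity
  rcases lt_or_ge 1 ε with h1 | h1
  · have h2 : (1 : ℝ) ≤ 4 ^ K := one_le_pow₀ (by norm_num)
    exact (hg.abs_le_one h0).trans (one_le_mul_of_one_le_of_one_le h2
      (Real.one_le_rpow h1.le hKθ.le))
  obtain ⟨j, hjK, hj⟩ : ∃ j < K, ENNReal.ofReal (c * (c / 192)) ≤
      volume (F ∩ Icc (j * (c / 192)) ((j + 1) * (c / 192))) := by
    by_contra! hcon
    have hcover : F ⊆ ⋃ j ∈ Finset.range K,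
        F ∩ Icc (j * (c / 192)) ((j + 1) * (c / 192)) := fun s hs => by
      have hs0 : 0 ≤ s / (c / 192) := div_nonneg (hFS hs).1 hδ.le
      simp only [mem_iUnion, Finset.mem_range]
      refine ⟨⌊s / (c / 192)⌋₊, Nat.lt_succ_of_le (Nat.floor_le_floor ?_), hs, ?_, ?_⟩
      · exact div_le_div_of_nonneg_right (hFS hs).2 hδ.le
      · exact (le_div_iff₀ hδ).1 (Nat.floor_le hs0)
      · exact ((div_lt_iff₀ hδ).1 (Nat.lt_floor_add_one _)).le
    have hlt : volume F < ENNReal.ofReal m := by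
      calc volume F ≤ ∑ j ∈ Finset.range K,
            volume (F ∩ Icc (j * (c / 192)) ((j + 1) * (c / 192))) :=
            (measure_mono hcover).trans (measure_biUnion_finset_le _ _)
        _ ≤ ∑ _j ∈ Finset.range K, ENNReal.ofReal (c * (c / 192)) :=
            Finset.sum_le_sum fun j hj => (hcon j (Finset.mem_range.1 hj)).le
        _ = ENNReal.ofReal (K * (c * (c / 192))) := by
            rw [ENNReal.ofReal_mul (Nat.cast_nonneg K)]; simp
        _ < ENNReal.ofReal m := (ENNReal.ofReal_lt_ofReal_iff hm).2 (by nlinarith)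
    exact absurd hvol (not_le.2 hlt)
  refine (hg.abs_zero_le_of_subset_Icc hJ h0 hc hc1 j (inter_subset_left.trans hFJ)
    inter_subset_right hj hε fun s hs => hgF s hs.1).trans ?_
  refine mul_le_mul (pow_le_pow_right₀ (by norm_num) hjK) ?_ (by positivity) (by positivity)
  exact Real.rpow_le_rpow_of_exponent_ge hε h1 (pow_le_pow_of_le_one hθ0.le hθ1.le hjK)

theorem hasTaylorApprox_of_abs_iteratedDeriv_le {g : ℝ → ℝ} {U : Set ℝ} (hU : IsOpen U)
    (hconn : U.OrdConnected) (hg : ContDiffOn ℝ (⊤ : ℕ∞) g U)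
    (hbound : ∀ k : ℕ, ∀ y ∈ U, |iteratedDeriv k g y| ≤ k.factorial) : HasTaylorApprox g U := by
  intro a ha b hb hab k
  cases k with
  | zero =>
    refine ⟨0, by simp, fun s hs => ?_⟩
    simpa using hbound 0 s (hconn.out ha hb hs)
  | succ m =>
    have hsub : Icc a b ⊆ U := hconn.out ha hb
    rcases hab.eq_or_lt with rfl | hlt
    · refine ⟨Polynomial.C (g a), Polynomial.degree_C_lt.trans_le ?_, fun s hs => ?_⟩
      · exact_mod_cast Nat.succ_le_succ (Nat.zero_le m)
      · obtain rfl : s = a := by simpa using hs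
        simp
    refine ⟨∑ i ∈ Finset.range (m + 1), Polynomial.C ((i.factorial : ℝ)⁻¹ *
      iteratedDerivWithin i g (Icc a b) a) * (Polynomial.X - Polynomial.C a) ^ i, ?_, ?_⟩
    · refine (Polynomial.degree_sum_le _ _).trans_lt ((Finset.sup_lt_iff ?_).2 fun i hi => ?_)
      · exact WithBot.bot_lt_coe _
      · refine (Polynomial.degree_mul_le_of_le Polynomial.degree_C_le le_rfl).trans_lt ?_
        rw [Polynomial.degree_pow, Polynomial.degree_X_sub_C, nsmul_one, zero_add]
        exact_mod_cast Finset.mem_range.1 hi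
    · intro s hs
      have htaylor := taylor_mean_remainder_bound (n := m) (C := (m + 1).factorial) hlt.le
        ((hg.mono hsub).of_le (by exact_mod_cast le_top)) hs fun y hy => by
          rw [iteratedDerivWithin_eq_iteratedDeriv (uniqueDiffOn_Icc hlt)
            ((hg.contDiffAt (hU.mem_nhds (hsub hy))).of_le (by exact_mod_cast le_top)) hy]
          exact hbound _ y (hsub hy)
      rw [taylor_within_apply, Real.norm_eq_abs] at htaylor
      have heval : (∑ i ∈ Finset.range (m + 1), Polynomial.C ((i.factorial : ℝ)⁻¹ *
          iteratedDerivWithin i g (Icc a b) a) * (Polynomial.X - Polynomial.C a) ^ i).eval s =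
          ∑ i ∈ Finset.range (m + 1),
            ((i.factorial : ℝ)⁻¹ * (s - a) ^ i) • iteratedDerivWithin i g (Icc a b) a := by
        rw [Polynomial.eval_finsetSum]
        refine Finset.sum_congr rfl fun i _ => ?_
        simp; ring
      rw [heval]
      refine htaylor.trans ?_
      have h1 : ((m + 1 : ℕ) : ℝ) ≤ 2 ^ (m + 1) := by exact_mod_cast (Nat.lt_two_pow_self).le
      have h2 : (0 : ℝ) ≤ (s - a) ^ (m + 1) := pow_nonneg (sub_nonneg.2 hs.1) _
      rw [mul_pow, Nat.factorial_succ]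
      calc _ = ((m + 1 : ℕ) : ℝ) * (s - a) ^ (m + 1) := by push_cast; field_simp
        _ ≤ _ := by gcongr

theorem ordConnected_line_preimage {V : Type*} [AddCommGroup V] [Module ℝ V] {B : Set V}
    (hB : Convex ℝ B) (x v : V) : {s : ℝ | x + s • v ∈ B}.OrdConnected := by
  have hpre : {s : ℝ | x + s • v ∈ B} = (AffineMap.lineMap x (x + v) : ℝ →ᵃ[ℝ] V) ⁻¹' B := by
    ext s
    simp [AffineMap.lineMap_apply, add_comm]
  rw [hpre]
  exact (hB.affine_preimage _).ordConnected

open scoped Pointwise in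
theorem hasTaylorApprox_comp_line {V : Type*} [NormedAddCommGroup V] [NormedSpace ℝ V]
    {f : V → ℝ} {B : Set V} (hB : IsOpen B) (hconv : Convex ℝ B) {M r : ℝ} (hM : 0 < M)
    (hr : 0 < r) (hf : ContDiffOn ℝ (⊤ : ℕ∞) f B)
    (hbound : ∀ k : ℕ, ∀ x ∈ B, ‖iteratedFDerivWithin ℝ k f B x‖ ≤ M * k.factorial / r ^ k)
    (x : V) {v : V} (hv : ‖v‖ ≤ r) :
    HasTaylorApprox (fun s : ℝ => M⁻¹ * f (x + s • v)) {s : ℝ | x + s • v ∈ B} := by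
  set U : Set ℝ := {s : ℝ | x + s • v ∈ B} with hU
  have hline : Continuous fun s : ℝ => x + s • v := by fun_prop
  have hUo : IsOpen U := hB.preimage hline
  have hfU : ContDiffOn ℝ (⊤ : ℕ∞) (fun s : ℝ => f (x + s • v)) U :=
    hf.comp (by fun_prop) fun s hs => hs
  refine hasTaylorApprox_of_abs_iteratedDeriv_le hUo (ordConnected_line_preimage hconv x v)
    (contDiffOn_const.mul hfU) fun k y hy => ?_
  set B' : Set V := (fun z => x + z) ⁻¹' B with hB'
  have hB'o : IsOpen B' := hB.preimage (by fun_prop)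
  have hvadd : x +ᵥ B' = B := by
    ext z
    simp [hB', Set.mem_vadd_set_iff_neg_vadd_mem]
  let L : ℝ →L[ℝ] V := ContinuousLinearMap.toSpanSingleton ℝ v
  have hLU : L ⁻¹' B' = U := by ext s; simp [L, hB', hU]
  have hcomp := L.iteratedFDerivWithin_comp_right (f := fun z => f (x + z)) (n := (⊤ : ℕ∞))
    (s := B') (hf.comp (by fun_prop) fun z hz => hz) hB'o.uniqueDiffOn
    (by rw [hLU]; exact hUo.uniqueDiffOn) (x := y) (show x + y • v ∈ B from hy) (i := k)
    (by exact_mod_cast le_top)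
  have hnorm : ‖iteratedDeriv k (fun s : ℝ => f (x + s • v)) y‖ ≤ M * k.factorial := by
    have h1 : iteratedFDerivWithin ℝ k ((fun z => f (x + z)) ∘ L) (L ⁻¹' B') y =
        iteratedFDeriv ℝ k (fun s : ℝ => f (x + s • v)) y := by
      rw [hLU]
      exact iteratedFDerivWithin_of_isOpen k hUo hy
    have hLn : ‖L‖ ≤ r := by simpa [L] using hv
    have hy' : x + L y ∈ B := hy
    rw [← norm_iteratedFDeriv_eq_norm_iteratedDeriv, ← h1, hcomp, iteratedFDerivWithin_comp_add_left,
      hvadd]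
    refine (ContinuousMultilinearMap.norm_compContinuousLinearMap_le _ _).trans ?_
    rw [Finset.prod_const, Finset.card_univ, Fintype.card_fin]
    calc _ ≤ M * k.factorial / r ^ k * r ^ k := by
          gcongr
          exact hbound k _ hy'
      _ = _ := by field_simp
  rw [iteratedDeriv_const_mul_field, abs_mul, abs_of_pos (inv_pos.2 hM), inv_mul_le_iff₀ hM]
  exact hnorm

theorem exists_le_volume_line_slice {V : Type*} [NormedAddCommGroup V] [NormedSpace ℝ V]
    [FiniteDimensional ℝ V] [MeasurableSpace V] [BorelSpace V] (μ : Measure V)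
    [μ.IsAddHaarMeasure] {A : Set V} (hA : MeasurableSet A) (x : V) {r S m : ℝ} (hr : 0 < r)
    (hS : 0 < S) (hm : 0 < m) (hAx : ∀ y ∈ A, ‖y - x‖ < r * (S / 2))
    (hmA : ENNReal.ofReal m * μ (Metric.ball 0 r) ≤ μ A) :
    ∃ v ∈ Metric.ball (0 : V) r,
      ENNReal.ofReal (S / 4 * (S ^ Module.finrank ℝ V)⁻¹ * m) ≤
        volume {s : ℝ | s ∈ Icc 0 S ∧ x + s • v ∈ A} := by
  by_contra! hcon
  set n := Module.finrank ℝ V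
  set c := S / 4 * (S ^ n)⁻¹ * m with hc
  have hc0 : 0 < c := by positivity
  set W : Set (V × ℝ) := {p | p.1 ∈ Metric.ball (0 : V) r ∧ p.2 ∈ Icc 0 S ∧ x + p.2 • p.1 ∈ A}
  have hW : MeasurableSet W := by
    have hmeas : Measurable fun p : V × ℝ => x + p.2 • p.1 :=
      (by fun_prop : Continuous fun p : V × ℝ => x + p.2 • p.1).measurable
    exact (measurable_fst measurableSet_ball).inter
      ((measurable_snd measurableSet_Icc).inter (hmeas hA))
  have hupper : (μ.prod volume) W ≤ ENNReal.ofReal c * μ (Metric.ball 0 r) := by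
    rw [Measure.prod_apply hW, ← setLIntegral_const]
    rw [← lintegral_indicator measurableSet_ball]
    refine lintegral_mono fun v => ?_
    by_cases hv : v ∈ Metric.ball (0 : V) r
    · rw [indicator_of_mem hv]
      refine (measure_mono ?_).trans (hcon v hv).le
      exact fun s hs => hs.2
    · have : Prod.mk v ⁻¹' W = ∅ := eq_empty_of_forall_notMem fun s hs => hv hs.1
      simp [this]
  have hlower : ENNReal.ofReal (2 * c) * μ (Metric.ball 0 r) ≤ (μ.prod volume) W := by
    rw [Measure.prod_apply_symm hW]
    calc ENNReal.ofReal (2 * c) * μ (Metric.ball 0 r)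
        = ENNReal.ofReal (S ^ n)⁻¹ * (ENNReal.ofReal m * μ (Metric.ball 0 r)) *
            volume (Icc (S / 2) S) := by
          rw [Real.volume_Icc, show 2 * c = (S ^ n)⁻¹ * m * (S - S / 2) by rw [hc]; ring,
            ENNReal.ofReal_mul (by positivity), ENNReal.ofReal_mul (by positivity)]
          ring
      _ ≤ ENNReal.ofReal (S ^ n)⁻¹ * μ A * volume (Icc (S / 2) S) := by gcongr
      _ = ∫⁻ _s in Icc (S / 2) S, ENNReal.ofReal (S ^ n)⁻¹ * μ A := (setLIntegral_const _ _).symm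
      _ ≤ ∫⁻ s in Icc (S / 2) S, μ ((fun v => (v, s)) ⁻¹' W) := by
          refine setLIntegral_mono' measurableSet_Icc fun s hs => ?_
          have hs0 : 0 < s := by linarith [hs.1]
          calc ENNReal.ofReal (S ^ n)⁻¹ * μ A ≤ ENNReal.ofReal |(s ^ n)⁻¹| * μ A := by
                rw [abs_of_pos (by positivity)]
                gcongr
                exact hs.2
            _ = μ ((fun v => s • v) ⁻¹' ((fun y => x + y) ⁻¹' A)) := by
                rw [Measure.addHaar_preimage_smul μ hs0.ne', measure_preimage_add]
            _ ≤ μ ((fun v => (v, s)) ⁻¹' W) := by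
                refine measure_mono fun v hv => ⟨?_, ⟨hs0.le, hs.2⟩, hv⟩
                have h1 := hAx _ hv
                rw [add_sub_cancel_left, norm_smul, Real.norm_eq_abs, abs_of_pos hs0] at h1
                rw [mem_ball_zero_iff]
                by_contra! h2
                nlinarith [hs.1]
      _ ≤ ∫⁻ s, μ ((fun v => (v, s)) ⁻¹' W) := setLIntegral_le_lintegral _ _
  have hball0 : μ (Metric.ball (0 : V) r) ≠ 0 := (Metric.measure_ball_pos μ 0 hr).ne'
  have hballt : μ (Metric.ball (0 : V) r) ≠ ⊤ := measure_ball_lt_top.ne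
  have h := (ENNReal.mul_le_mul_iff_left hball0 hballt).1 (hlower.trans hupper)
  rw [ENNReal.ofReal_le_ofReal_iff hc0.le] at h
  linarith

theorem half_measure_le_of_average_lt {α : Type*} [MeasurableSpace α] {μ : Measure α} {E : Set α}
    {f : α → ℝ} (hE : MeasurableSet E) (hE0 : μ E ≠ 0)
    (hEt : μ E ≠ ⊤) (hf : IntegrableOn f E μ) {ε : ℝ}
    (hε : (∫ y in E, |f y| ∂μ) / (μ E).toReal < ε) :
    μ E / 2 ≤ μ (E ∩ {y | |f y| < 2 * ε}) := by
  have hpos : 0 < (μ E).toReal := ENNReal.toReal_pos hE0 hEt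
  have hε0 : 0 < ε := lt_of_le_of_lt (by positivity) hε
  rw [div_lt_iff₀ hpos] at hε
  have hmarkov := mul_meas_ge_le_integral_of_nonneg (μ := μ.restrict E) (f := fun y => |f y|)
    (Filter.Eventually.of_forall fun _ => abs_nonneg _) hf.abs (2 * ε)
  have hbad : (μ.restrict E) {y | 2 * ε ≤ |f y|} ≤ μ E / 2 := by
    have h1 : (μ.restrict E).real {y | 2 * ε ≤ |f y|} ≤ (μ E).toReal / 2 := by
      have h2 := hmarkov.trans hε.le
      nlinarith
    have hfin : (μ.restrict E) {y | 2 * ε ≤ |f y|} ≠ ⊤ :=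
      ((measure_mono (subset_univ _)).trans_lt (by
        rw [Measure.restrict_apply_univ]; exact hEt.lt_top)).ne
    rw [← ENNReal.toReal_le_toReal hfin (ENNReal.div_ne_top hEt two_ne_zero), ENNReal.toReal_div]
    exact h1
  have hsplit : μ E ≤ (μ.restrict E) {y | 2 * ε ≤ |f y|} + μ (E ∩ {y | |f y| < 2 * ε}) := by
    calc μ E = (μ.restrict E) univ := (Measure.restrict_apply_univ E).symm
      _ ≤ (μ.restrict E) {y | 2 * ε ≤ |f y|} + (μ.restrict E) {y | |f y| < 2 * ε} := by
        refine (measure_mono fun y _ => ?_).trans (measure_union_le _ _)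
        exact le_or_gt (2 * ε) |f y|
      _ = _ := by
        rw [Measure.restrict_apply' (s := E) (t := {y | |f y| < 2 * ε}) hE, inter_comm E]
  have h1 : μ E / 2 + μ E / 2 ≤ μ E / 2 + μ (E ∩ {y | |f y| < 2 * ε}) := by
    rw [ENNReal.add_halves]
    exact hsplit.trans (by gcongr)
  exact (ENNReal.add_le_add_iff_left (ENNReal.div_ne_top hEt two_ne_zero)).1 h1

/-- Theorem 2.1, Vessella: propagation of smallness from measurable
sets for real-analytic functions on a ball, with constants depending only on `ρ`
and the relative measure `|E|/|B_R|`. -/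
theorem stmt_10 {n : ℕ} (ρ κ : ℝ) (hρ : ρ ∈ Set.Ioc (0 : ℝ) 1) (hκ : 0 < κ) :
    ∃ N θ : ℝ, 0 < N ∧ θ ∈ Set.Ioo (0 : ℝ) 1 ∧
      ∀ (R M : ℝ) (f : EuclideanSpace ℝ (Fin n) → ℝ) (E : Set (EuclideanSpace ℝ (Fin n))),
        0 < R → 0 < M →
        ContDiffOn ℝ (⊤ : ℕ∞) f (Metric.ball 0 (2 * R)) →
        (∀ k : ℕ, ∀ x ∈ Metric.ball (0 : EuclideanSpace ℝ (Fin n)) (2 * R),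
          ‖iteratedFDerivWithin ℝ k f (Metric.ball 0 (2 * R)) x‖
            ≤ M * (Nat.factorial k) / (ρ * R) ^ k) →
        MeasurableSet E → E ⊆ Metric.ball 0 R →
        volume E = ENNReal.ofReal κ * volume (Metric.ball (0 : EuclideanSpace ℝ (Fin n)) R) →
        ∀ x ∈ Metric.ball (0 : EuclideanSpace ℝ (Fin n)) R,
          |f x| ≤ N * ((∫ y in E, |f y|) / (volume E).toReal) ^ θ * M ^ (1 - θ) := by
  have hρ0 : 0 < ρ := hρ.1
  obtain ⟨N, θ, hN, hθ, hline⟩ := exists_abs_zero_le_mul_rpow (S := 4 / ρ)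
    (m := 4 / ρ / 4 * ((4 / ρ) ^ Module.finrank ℝ (EuclideanSpace ℝ (Fin n)))⁻¹ * (κ / 2))
    (by positivity) (by positivity)
  refine ⟨N * 2 ^ θ, θ, by positivity, hθ, ?_⟩
  intro R M f E hR hM hf hbound hE hER hvol x hx
  set B : Set (EuclideanSpace ℝ (Fin n)) := Metric.ball 0 (2 * R)
  have hBR : Metric.ball (0 : EuclideanSpace ℝ (Fin n)) R ⊆ B :=
    Metric.ball_subset_ball (by linarith)
  have hBt : volume (Metric.ball (0 : EuclideanSpace ℝ (Fin n)) R) ≠ ⊤ := measure_ball_lt_top.ne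
  have hB0 : volume (Metric.ball (0 : EuclideanSpace ℝ (Fin n)) R) ≠ 0 :=
    (Metric.measure_ball_pos volume 0 hR).ne'
  have hE0 : volume E ≠ 0 := by
    rw [hvol]; exact mul_ne_zero (ENNReal.ofReal_pos.2 hκ).ne' hB0
  have hEt : volume E ≠ ⊤ := by
    rw [hvol]; exact ENNReal.mul_ne_top ENNReal.ofReal_ne_top hBt
  have hfM : ∀ y ∈ B, ‖f y‖ ≤ M := fun y hy => by simpa using hbound 0 y hy
  have hint : IntegrableOn f E := by
    refine IntegrableOn.of_bound hEt.lt_top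
      ((hf.continuousOn.mono (hER.trans hBR)).aestronglyMeasurable hE) M ?_
    exact (ae_restrict_iff' hE).2 (Filter.Eventually.of_forall fun y hy => hfM y (hBR (hER hy)))
  set a := (∫ y in E, |f y|) / (volume E).toReal
  have hsmall : ∀ ε, a < ε → |f x| ≤ N * 2 ^ θ * ε ^ θ * M ^ (1 - θ) := by
    intro ε hε
    have hε0 : 0 < ε := lt_of_le_of_lt (by positivity) hε
    set A := E ∩ {y | |f y| < 2 * ε}
    have hA : MeasurableSet A := by
      have hopen : IsOpen (B ∩ {y | |f y| < 2 * ε}) :=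
        hf.continuousOn.abs.isOpen_inter_preimage Metric.isOpen_ball isOpen_Iio
      have : A = E ∩ (B ∩ {y | |f y| < 2 * ε}) := by
        rw [← inter_assoc, inter_eq_left.2 (hER.trans hBR)]
      rw [this]
      exact hE.inter hopen.measurableSet
    have hAvol : ENNReal.ofReal (κ / 2) *
        volume (Metric.ball (0 : EuclideanSpace ℝ (Fin n)) (ρ * R)) ≤ volume A := by
      refine le_trans ?_ (half_measure_le_of_average_lt hE hE0 hEt hint hε)
      rw [hvol, ENNReal.ofReal_div_of_pos two_pos, ENNReal.ofReal_ofNat, div_eq_mul_inv,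
        div_eq_mul_inv, mul_right_comm]
      gcongr
      nlinarith [hρ.2]
    obtain ⟨v, hv, hvA⟩ := exists_le_volume_line_slice volume hA x (r := ρ * R) (S := 4 / ρ)
      (m := κ / 2) (by positivity) (by positivity) (by positivity) (fun y hy => by
        have h1 := mem_ball_zero_iff.1 (hER hy.1)
        have h2 := mem_ball_zero_iff.1 hx
        have h3 : ρ * R * (4 / ρ / 2) = 2 * R := by field_simp; norm_num
        linarith [norm_sub_le y x]) hAvol
    have happrox := hasTaylorApprox_comp_line Metric.isOpen_ball (convex_ball _ _) hM
      (by positivity) hf hbound x (mem_ball_zero_iff.1 hv).le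
    have key := hline _ _ _ (M⁻¹ * (2 * ε)) happrox
      (ordConnected_line_preimage (convex_ball _ _) x v) (by
        rw [mem_ofPred_eq, zero_smul, add_zero]; exact hBR hx)
      (fun s hs => hBR (hER hs.2.1)) (fun s hs => hs.1) hvA (by positivity) fun s hs => by
        rw [abs_mul, abs_of_pos (inv_pos.2 hM)]
        exact mul_le_mul_of_nonneg_left hs.2.2.le (by positivity)
    rw [zero_smul, add_zero, abs_mul, abs_of_pos (inv_pos.2 hM), inv_mul_le_iff₀ hM] at key
    refine key.trans_eq ?_
    rw [Real.mul_rpow (by positivity) (by positivity), Real.mul_rpow (by positivity) hε0.le,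
      Real.inv_rpow hM.le, Real.rpow_sub hM, Real.rpow_one]
    field_simp
  have hcont : Filter.Tendsto (fun ε : ℝ => N * 2 ^ θ * ε ^ θ * M ^ (1 - θ)) (nhdsWithin a (Ioi a))
      (nhds (N * 2 ^ θ * a ^ θ * M ^ (1 - θ))) :=
    (((Real.continuousAt_rpow_const a θ (Or.inr hθ.1.le)).tendsto.const_mul _).mul_const _).mono_left
      nhdsWithin_le_nhds
  exact ge_of_tendsto hcont (Filter.eventually_of_mem self_mem_nhdsWithin hsmall)
end
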